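/- Let ψ₁ and ψ₂ be the alternating bilinear forms on ℂ⁵ given by ψ₁(x,y) = x₁y₂ − x₂y₁ and ψ₂(x,y) = x₃y₄ − x₄y₃. A 3-dimensional subspace V ⊆ ℂ⁵ is isotropic for both ψ₁ and ψ₂ (i.e. ψ₁ and ψ₂ vanish identically on V × V) if and only if V = span{u, w, e₅} for some nonzero u ∈ span{e₁,e₂} and some nonzero w ∈ span{e₃,e₄}. Hence the family of such 3-planes is parametrized by P¹ × P¹. -/

import Mathlib

/-- The decomposable alternating form `ψ₁ = e₁*∧e₂*` on `ℂ⁵` (0-indexed coordinates). -/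
noncomputable def psi1 : (Fin 5 → ℂ) → (Fin 5 → ℂ) → ℂ := fun x y =>
  x 0 * y 1 - x 1 * y 0

/-- The decomposable alternating form `ψ₂ = e₃*∧e₄*` on `ℂ⁵` (0-indexed coordinates). -/
noncomputable def psi2 : (Fin 5 → ℂ) → (Fin 5 → ℂ) → ℂ := fun x y =>
  x 2 * y 3 - x 3 * y 2

theorem exists_direction (V : Submodule ℂ (Fin 5 → ℂ)) (i j : Fin 5)
    (h : ∀ u ∈ V, ∀ w ∈ V, u i * w j - u j * w i = 0) :
    ∃ p q : ℂ, (p ≠ 0 ∨ q ≠ 0) ∧ ∀ v ∈ V, ∃ c : ℂ, v i = c * p ∧ v j = c * q := by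
  by_cases H : ∃ v ∈ V, v i ≠ 0 ∨ v j ≠ 0
  · obtain ⟨v, hv, hne⟩ := H
    refine ⟨v i, v j, hne, fun w hw => ?_⟩
    have e := h v hv w hw
    rcases hne with hne | hne
    · refine ⟨w i / v i, by field_simp, ?_⟩
      field_simp
      linear_combination e
    · refine ⟨w j / v j, ?_, by field_simp⟩
      field_simp
      linear_combination -e
  · push Not at H
    exact ⟨1, 0, Or.inl one_ne_zero, fun v hv => ⟨0, by simp [H v hv]⟩⟩

/-- A 3-plane of `ℂ⁵` is isotropic for both `ψ₁` and `ψ₂` iff it is spanned by `e₅`, a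
nonzero vector of `span{e₁,e₂}` and a nonzero vector of `span{e₃,e₄}`; hence such
3-planes are parametrized by `P¹ × P¹`. -/
theorem common_isotropic_three_planes_of_two_rank_two_forms
    (V : Submodule ℂ (Fin 5 → ℂ)) (hdim : Module.finrank ℂ V = 3) :
    ((∀ u ∈ V, ∀ w ∈ V, psi1 u w = 0) ∧ (∀ u ∈ V, ∀ w ∈ V, psi2 u w = 0)) ↔
      ∃ u w : Fin 5 → ℂ, u ≠ 0 ∧ w ≠ 0 ∧
        u ∈ Submodule.span ℂ ({Pi.single 0 1, Pi.single 1 1} : Set (Fin 5 → ℂ)) ∧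
        w ∈ Submodule.span ℂ ({Pi.single 2 1, Pi.single 3 1} : Set (Fin 5 → ℂ)) ∧
        V = Submodule.span ℂ ({u, w, Pi.single 4 1} : Set (Fin 5 → ℂ)) := by
  constructor
  · rintro ⟨h1, h2⟩
    obtain ⟨p, q, hpq, H1⟩ := exists_direction V 0 1 h1
    obtain ⟨r, s, hrs, H2⟩ := exists_direction V 2 3 h2
    refine ⟨![p, q, 0, 0, 0], ![0, 0, r, s, 0], ?_, ?_, ?_, ?_, ?_⟩
    · intro h
      have a := congrFun h 0
      have b := congrFun h 1
      simp at a b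
      simp [a, b] at hpq
    · intro h
      have a := congrFun h 2
      have b := congrFun h 3
      simp at a b
      simp [a, b] at hrs
    · rw [Submodule.mem_span_pair]
      refine ⟨p, q, ?_⟩
      ext k
      fin_cases k <;> simp
    · rw [Submodule.mem_span_pair]
      refine ⟨r, s, ?_⟩
      ext k
      fin_cases k <;> simp
    · apply Submodule.eq_of_le_of_finrank_le
      · intro v hv
        obtain ⟨c, hc0, hc1⟩ := H1 v hv
        obtain ⟨d, hd0, hd1⟩ := H2 v hv
        rw [Submodule.mem_span_triple]
        refine ⟨c, d, v 4, ?_⟩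
        ext k
        fin_cases k <;> simp [hc0, hc1, hd0, hd1]
      · rw [hdim]
        classical
        have := finrank_span_finset_le_card (R := ℂ)
          ({![p, q, 0, 0, 0], ![0, 0, r, s, 0], Pi.single 4 1} : Finset (Fin 5 → ℂ))
        have h3 := Finset.card_le_three (a := (![p, q, 0, 0, 0] : Fin 5 → ℂ))
          (b := ![0, 0, r, s, 0]) (c := Pi.single 4 1)
        rw [Set.finrank, Finset.coe_insert, Finset.coe_insert, Finset.coe_singleton] at this
        exact this.trans h3
  · rintro ⟨u, w, -, -, hu, hw, rfl⟩
    rw [Submodule.mem_span_pair] at hu hw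
    obtain ⟨p, q, rfl⟩ := hu
    obtain ⟨r, s, rfl⟩ := hw
    constructor <;>
    · intro x hx y hy
      rw [Submodule.mem_span_triple] at hx hy
      obtain ⟨a, b, c, rfl⟩ := hx
      obtain ⟨a', b', c', rfl⟩ := hy
      simp [psi1, psi2]
      ring
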